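/- Let α, β > 0 and b ∈ ℝ satisfy 2√(αβ) − |b| ≥ 0. Let C : ℝ → ℝ³ be a C² curve which is L-periodic for some L > 0 and parameterized by arc length, with curvature κ(s) := ‖C''(s)‖, and let g : ℝ → ℝ be any continuous L-periodic function with |g(s)| ≤ κ(s) for all s. Then ∫₀^L (α·κ(s)² + b·g(s) + β) ds ≥ 2π(2√(αβ) − |b|). -/

import Mathlib

open Real MeasureTheory intervalIntegral

theorem wirtinger_aux (f f' : ℝ → ℝ) (L : ℝ) (hL : 0 < L)
    (hf : ∀ x, HasDerivAt f (f' x) x) (hf' : Continuous f')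
    (hend : f L = f 0) (hmean : ∫ x in (0:ℝ)..L, f x = 0) :
    (2 * π / L) ^ 2 * ∫ x in (0:ℝ)..L, f x ^ 2 ≤ ∫ x in (0:ℝ)..L, f' x ^ 2 := by
  have hfc : Continuous f := continuous_iff_continuousAt.2 fun x => (hf x).continuousAt
  have mem : ∀ h : ℝ → ℝ, Continuous h →
      MemLp (fun x => (h x : ℂ)) 2 (volume.restrict (Set.Ioc 0 L)) := by
    intro h hh
    have hc : Continuous (fun x => (h x : ℂ)) := by fun_prop
    obtain ⟨B, hB⟩ := isCompact_Icc.exists_bound_of_continuousOn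
      (hc.continuousOn (s := Set.Icc 0 L))
    refine MemLp.of_bound hc.aestronglyMeasurable B ?_
    exact (ae_restrict_iff' measurableSet_Ioc).2
      (Filter.Eventually.of_forall fun x hx => hB x (Set.Ioc_subset_Icc_self hx))
  have h1 := hasSum_sq_fourierCoeffOn hL (mem f hfc)
  have h2 := hasSum_sq_fourierCoeffOn hL (mem f' hf')
  have key : ∀ n : ℤ, (2 * π / L) ^ 2 * ‖fourierCoeffOn hL (fun x => (f x : ℂ)) n‖ ^ 2 ≤
      ‖fourierCoeffOn hL (fun x => (f' x : ℂ)) n‖ ^ 2 := by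
    intro n
    by_cases hn : n = 0
    · subst hn
      have : fourierCoeffOn hL (fun x => (f x : ℂ)) 0 = 0 := by
        rw [fourierCoeffOn_eq_integral]
        simp [intervalIntegral.integral_ofReal, hmean]
      rw [this]
      simp
    · have h := fourierCoeffOn_of_hasDerivAt hL (f := fun x => (f x : ℂ))
        (f' := fun x => (f' x : ℂ)) hn (fun x _ => (hf x).ofReal_comp)
        (Continuous.intervalIntegrable (by fun_prop) _ _)
      rw [h, hend]
      simp only [sub_self, mul_zero, zero_sub, Complex.ofReal_zero, sub_zero]
      rw [norm_mul, norm_neg, norm_mul, norm_div]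
      simp only [norm_mul, norm_neg, Complex.norm_I, Complex.norm_real, norm_one,
        Complex.norm_ofNat, Complex.norm_intCast, Real.norm_eq_abs, abs_of_pos hL,
        abs_of_pos Real.pi_pos, mul_one]
      set X := ‖fourierCoeffOn hL (fun x => (f' x : ℂ)) n‖
      have hn1 : (1:ℝ) ≤ |(n:ℝ)| := by exact_mod_cast Int.one_le_abs hn
      have hn0 : 0 < |(n:ℝ)| := by linarith
      have : (2 * π / L) ^ 2 * (1 / (2 * π * |(n:ℝ)|) * (L * X)) ^ 2 = X ^ 2 / |(n:ℝ)| ^ 2 := by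
        have := Real.pi_pos
        field_simp
      rw [this]
      exact div_le_self (sq_nonneg _) (one_le_pow₀ hn1)
  have h3 := hasSum_le key (h1.mul_left _) h2
  simp only [sub_zero, smul_eq_mul, Complex.norm_real, Real.norm_eq_abs, sq_abs] at h3
  have h4 : L⁻¹ * ((2 * π / L) ^ 2 * ∫ x in (0:ℝ)..L, f x ^ 2)
      ≤ L⁻¹ * ∫ x in (0:ℝ)..L, f' x ^ 2 := by linarith
  exact le_of_mul_le_mul_left h4 (inv_pos.2 hL)

theorem curvature_sq_aux (C : ℝ → EuclideanSpace ℝ (Fin 3)) (L : ℝ) (hL : 0 < L)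
    (hC : ContDiff ℝ 2 C)
    (hper : ∀ s, C (s + L) = C s)
    (harc : ∀ s, ‖deriv C s‖ = 1) :
    (2 * π / L) ^ 2 * L ≤ ∫ s in (0:ℝ)..L, ‖deriv (deriv C) s‖ ^ 2 := by
  have hC1 : ContDiff ℝ 1 (deriv C) := ((contDiff_succ_iff_deriv (n := 1)).1 hC).2.2
  have hC2 : Continuous (deriv (deriv C)) := hC1.continuous_deriv le_rfl
  have hd1 : ∀ x, HasDerivAt C (deriv C x) x := fun x =>
    ((hC.differentiable (by norm_num)) x).hasDerivAt
  have hd2 : ∀ x, HasDerivAt (deriv C) (deriv (deriv C) x) x := fun x =>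
    ((hC1.differentiable (by norm_num)) x).hasDerivAt
  have hc1 := hC1.continuous
  have hend : deriv C L = deriv C 0 := by
    have h : (fun s => C (s + L)) = C := funext hper
    have := deriv_comp_add_const C L 0
    rw [h] at this
    simpa using this.symm
  have comp : ∀ (h : ℝ → EuclideanSpace ℝ (Fin 3)) (h' : EuclideanSpace ℝ (Fin 3)) (x : ℝ)
      (i : Fin 3), HasDerivAt h h' x → HasDerivAt (fun s => h s i) (h' i) x := by
    intro h h' x i hh
    exact (EuclideanSpace.proj (𝕜 := ℝ) i).hasFDerivAt.comp_hasDerivAt x hh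
  have cc : ∀ (h : ℝ → EuclideanSpace ℝ (Fin 3)) (i : Fin 3), Continuous h →
      Continuous (fun s => h s i) := by
    intro h i hh
    exact (EuclideanSpace.proj (𝕜 := ℝ) i).continuous.comp hh
  have w : ∀ i : Fin 3, (2 * π / L) ^ 2 * ∫ x in (0:ℝ)..L, (deriv C x i) ^ 2 ≤
      ∫ x in (0:ℝ)..L, (deriv (deriv C) x i) ^ 2 := by
    intro i
    refine wirtinger_aux _ _ L hL (fun x => comp _ _ x i (hd2 x)) (cc _ i hC2)
      (by rw [hend]) ?_
    rw [integral_eq_sub_of_hasDerivAt (f := fun s => C s i) (fun x _ => comp _ _ x i (hd1 x))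
      ((cc _ i hc1).intervalIntegrable _ _)]
    have := hper 0
    rw [zero_add] at this
    simp [this]
  have e : ∀ h : ℝ → EuclideanSpace ℝ (Fin 3), Continuous h →
      ∫ s in (0:ℝ)..L, ‖h s‖ ^ 2 = ∑ i : Fin 3, ∫ s in (0:ℝ)..L, (h s i) ^ 2 := by
    intro h hh
    rw [← intervalIntegral.integral_finsetSum]
    · refine intervalIntegral.integral_congr fun s _ => ?_
      simp [EuclideanSpace.norm_sq_eq]
    · intro i _
      exact ((cc _ i hh).pow 2).intervalIntegrable _ _
  have e1 := e _ hc1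
  simp only [harc, one_pow, intervalIntegral.integral_const, sub_zero, smul_eq_mul, mul_one] at e1
  calc (2 * π / L) ^ 2 * L
      = ∑ i : Fin 3, (2 * π / L) ^ 2 * ∫ s in (0:ℝ)..L, (deriv C s i) ^ 2 := by
        rw [← Finset.mul_sum, ← e1]
    _ ≤ _ := by
        rw [e _ hC2]
        exact Finset.sum_le_sum fun i _ => w i



/-- If `2√(αβ) − |b| ≥ 0`, then for any closed unit-speed C² curve with
curvature `κ` and any continuous L-periodic function `g` with `|g| ≤ κ`, one has
`∫₀ᴸ (ακ² + b·g + β) ds ≥ 2π(2√(αβ) − |b|)`. -/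
theorem disc_boundary_energy_lower_bound
    (α β b : ℝ) (hα : 0 < α) (hβ : 0 < β)
    (hE : 0 ≤ 2 * Real.sqrt (α * β) - |b|)
    (C : ℝ → EuclideanSpace ℝ (Fin 3)) (L : ℝ) (hL : 0 < L)
    (hC : ContDiff ℝ 2 C)
    (hper : ∀ s, C (s + L) = C s)
    (harc : ∀ s, ‖deriv C s‖ = 1)
    (g : ℝ → ℝ) (hg : Continuous g)
    (hgper : ∀ s, g (s + L) = g s)
    (hgle : ∀ s, |g s| ≤ ‖deriv (deriv C) s‖) :
    2 * π * (2 * Real.sqrt (α * β) - |b|) ≤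
      ∫ s in (0:ℝ)..L, (α * ‖deriv (deriv C) s‖ ^ 2 + b * g s + β) := by
  have hw := curvature_sq_aux C L hL hC hper harc
  have hC1 : ContDiff ℝ 1 (deriv C) := ((contDiff_succ_iff_deriv (n := 1)).1 hC).2.2
  have hC2 : Continuous (deriv (deriv C)) := hC1.continuous_deriv le_rfl
  set k : ℝ → ℝ := fun s => ‖deriv (deriv C) s‖ with hk
  have hkc : Continuous k := hC2.norm
  have hk0 : ∀ s, 0 ≤ k s := fun s => norm_nonneg _
  have hgk : ∀ s, -(|b| * k s) ≤ b * g s := by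
    intro s
    have h1 : |b * g s| ≤ |b| * k s := by
      rw [abs_mul]
      exact mul_le_mul_of_nonneg_left (hgle s) (abs_nonneg b)
    exact (abs_le.1 h1).1
  have ha := Real.sq_sqrt hα.le
  have hc := Real.sq_sqrt hβ.le
  have hr : Real.sqrt (α * β) = Real.sqrt α * Real.sqrt β := Real.sqrt_mul hα.le β
  have hpi := Real.pi_pos
  have ii : ∀ h : ℝ → ℝ, Continuous h → IntervalIntegrable h volume 0 L :=
    fun h hh => hh.intervalIntegrable _ _
  by_cases hK : 2 * π ≤ ∫ s in (0:ℝ)..L, k s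
  · calc 2 * π * (2 * Real.sqrt (α * β) - |b|)
        ≤ (∫ s in (0:ℝ)..L, k s) * (2 * Real.sqrt (α * β) - |b|) :=
          mul_le_mul_of_nonneg_right hK hE
      _ = ∫ s in (0:ℝ)..L, k s * (2 * Real.sqrt (α * β) - |b|) := by
          rw [intervalIntegral.integral_mul_const]
      _ ≤ _ := by
          refine intervalIntegral.integral_mono_on hL.le (ii _ (by fun_prop))
            (ii (fun s => α * k s ^ 2 + b * g s + β) (by fun_prop)) fun s _ => ?_
          have := hgk s
          rw [hr]
          show _ ≤ α * k s ^ 2 + b * g s + β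
          nlinarith [sq_nonneg (Real.sqrt α * k s - Real.sqrt β)]
  · push Not at hK
    have h1 : ∫ s in (0:ℝ)..L, (α * k s ^ 2 + (-|b|) * k s + β) ≤
        ∫ s in (0:ℝ)..L, (α * k s ^ 2 + b * g s + β) := by
      refine intervalIntegral.integral_mono_on hL.le (ii _ (by fun_prop))
            (ii _ (by fun_prop)) fun s _ => ?_
      have := hgk s
      linarith
    have h2 : ∫ s in (0:ℝ)..L, (α * k s ^ 2 + (-|b|) * k s + β) =
        α * (∫ s in (0:ℝ)..L, k s ^ 2) + (-|b|) * (∫ s in (0:ℝ)..L, k s) + L * β := by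
      rw [intervalIntegral.integral_add (ii _ (by fun_prop)) (ii _ (by fun_prop)),
        intervalIntegral.integral_add (ii _ (by fun_prop)) (ii _ (by fun_prop)),
        intervalIntegral.integral_const_mul, intervalIntegral.integral_const_mul]
      simp
    refine le_trans ?_ h1
    rw [h2]
    have h3 : α * ((2 * π / L) ^ 2 * L) ≤ α * ∫ s in (0:ℝ)..L, k s ^ 2 :=
      mul_le_mul_of_nonneg_left hw hα.le
    have h4 : |b| * (∫ s in (0:ℝ)..L, k s) ≤ |b| * (2 * π) :=
      mul_le_mul_of_nonneg_left hK.le (abs_nonneg b)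
    have h5 : 4 * π * Real.sqrt (α * β) ≤ α * ((2 * π / L) ^ 2 * L) + L * β := by
      have h6 : α * ((2 * π / L) ^ 2 * L) + L * β - 4 * π * Real.sqrt (α * β) =
          (2 * π * Real.sqrt α - Real.sqrt β * L) ^ 2 / L := by
        rw [hr]
        field_simp
        linear_combination (-(4 * π ^ 2)) * ha - L ^ 2 * hc
      have : 0 ≤ (2 * π * Real.sqrt α - Real.sqrt β * L) ^ 2 / L := by positivity
      linarith
    linarith
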